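/- Let d ∈ {3, 4}, let c > 0 be a real number, and let ε > 0. There is a constant t(c, ε) > 0 such that for every natural number m, every finite set X ⊆ ℤ^d, and all pairwise distinct points p_1, …, p_{d−1} ∈ ℤ^d with ‖p_i‖_∞ ≤ m^c for all i, the number of x ∈ X for which p_1, …, p_{d−1} all lie on the sphere 𝒮_{d,m} + x (i.e. ‖p_i − x‖_2² = m for all i) is at most t(c, ε) · m^ε. -/

import Mathlib

open Finset

noncomputable section

lemma aux_dc {a b c : ℤ} (h : a ∣ b) (e : b = c) : a ∣ c := e ▸ h

lemma aux_dvd_two {s h : ℕ} (hs : Squarefree s) (hh : h * h ∣ 4 * s) : h ∣ 2 := by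
  rcases Nat.even_or_odd h with he | ho
  · obtain ⟨j, rfl⟩ := he
    have h1 : 4 * (j * j) ∣ 4 * s := by
      convert hh using 1; ring
    have h2 : j * j ∣ s := Nat.dvd_of_mul_dvd_mul_left (by norm_num) h1
    have h3 := Nat.isUnit_iff.mp (hs j h2)
    subst h3; norm_num
  · have hc : Nat.Coprime (h * h) 4 := by
      have : Nat.Coprime h 2 := Nat.coprime_two_right.mpr ho
      have h4 : Nat.Coprime h 4 := by
        have := Nat.Coprime.pow_right 2 this
        simpa using this
      exact Nat.Coprime.mul_left h4 h4
    have h2 : h * h ∣ s := hc.dvd_of_dvd_mul_left hh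
    have h3 := Nat.isUnit_iff.mp (hs h h2)
    subst h3; norm_num

lemma aux_root {D N : ℕ} (hN : 0 < N) (hsq : Squarefree (Nat.gcd D N)) {k k1 k2 : ℤ}
    (h0 : (N : ℤ) ∣ k ^ 2 + D) (h1 : (N : ℤ) ∣ k1 ^ 2 + D) (h2 : (N : ℤ) ∣ k2 ^ 2 + D)
    (hg : Int.gcd (k1 - k) N = Int.gcd (k2 - k) N) : (N : ℤ) ∣ 2 * (k1 - k2) := by
  obtain ⟨g, hgdef⟩ : ∃ g, g = Int.gcd (k1 - k) N := ⟨_, rfl⟩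
  have hgN : g ∣ N := by
    have := Int.gcd_dvd_right (k1 - k) (N : ℤ)
    rw [hgdef]; exact_mod_cast this
  obtain ⟨n, hn⟩ := hgN
  have hgpos : 0 < g := by
    rcases Nat.eq_zero_or_pos g with h | h
    · subst h; simp at hn; omega
    · exact h
  have key : ∀ a : ℤ, (N : ℤ) ∣ a ^ 2 + D → g = Int.gcd (a - k) N →
      (g : ℤ) ∣ a - k ∧ (n : ℤ) ∣ a + k := by
    intro a ha hga
    have hd : (g : ℤ) ∣ a - k := by rw [hga]; exact Int.gcd_dvd_left _ _
    refine ⟨hd, ?_⟩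
    obtain ⟨b, hb⟩ := hd
    have hN2 : (N : ℤ) ∣ (a - k) * (a + k) := by
      have := dvd_sub ha h0
      exact aux_dc this (by ring)
    rw [hb, hn, mul_assoc] at hN2
    push_cast at hN2
    have h3 : (n : ℤ) ∣ b * (a + k) := Int.dvd_of_mul_dvd_mul_left (by exact_mod_cast hgpos.ne') hN2
    have h4 : Int.gcd b n = 1 := by
      rw [hb, hn] at hga
      push_cast at hga
      rw [Int.gcd_mul_left] at hga
      simp only [Int.natAbs_natCast] at hga
      exact Nat.eq_of_mul_eq_mul_left hgpos (by omega)
    exact Int.dvd_of_dvd_mul_right_of_gcd_one h3 (by rw [Int.gcd_comm]; exact h4)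
  obtain ⟨ha1, hb1⟩ := key k1 h1 hgdef
  obtain ⟨ha2, hb2⟩ := key k2 h2 (hgdef.trans hg)
  have hgd : (g : ℤ) ∣ k1 - k2 := by
    have := dvd_sub ha1 ha2; exact aux_dc this (by ring)
  have hnd : (n : ℤ) ∣ k1 - k2 := by
    have := dvd_sub hb1 hb2; exact aux_dc this (by ring)
  obtain ⟨h, hh⟩ : ∃ h, h = Nat.gcd g n := ⟨_, rfl⟩
  have hhg : h ∣ g := hh ▸ Nat.gcd_dvd_left _ _
  have hhn : h ∣ n := hh ▸ Nat.gcd_dvd_right _ _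
  have hhN : h * h ∣ N := hn ▸ mul_dvd_mul hhg hhn
  have hk : (h : ℤ) ∣ 2 * k1 := by
    have := dvd_add ((Int.natCast_dvd_natCast.mpr hhg).trans ha1)
      ((Int.natCast_dvd_natCast.mpr hhn).trans hb1)
    exact aux_dc this (by ring)
  have hhD : h * h ∣ 4 * D := by
    have e1 : (h * h : ℤ) ∣ 4 * k1 ^ 2 := by
      have := mul_dvd_mul hk hk; exact aux_dc this (by ring)
    have e2 : (h * h : ℤ) ∣ 4 * (k1 ^ 2 + D) :=
      Dvd.dvd.mul_left ((by exact_mod_cast hhN : (h * h : ℤ) ∣ N).trans h1) 4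
    have := dvd_sub e2 e1
    have e3 : (h * h : ℤ) ∣ 4 * D := by exact aux_dc this (by ring)
    exact_mod_cast e3
  have hh4 : h * h ∣ 4 * Nat.gcd D N := by
    rw [← Nat.gcd_mul_left]
    exact Nat.dvd_gcd hhD (Dvd.dvd.mul_left hhN 4)
  have h2' := aux_dvd_two hsq hh4
  have hl : ((Nat.lcm g n : ℕ) : ℤ) ∣ k1 - k2 := by
    rw [Int.natCast_dvd] at hgd hnd ⊢
    exact Nat.lcm_dvd hgd hnd
  have e : (N : ℤ) = (h : ℤ) * (Nat.lcm g n : ℕ) := by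
    rw [hn, hh, ← Nat.gcd_mul_lcm g n]; push_cast; ring
  rw [e]
  exact mul_dvd_mul (by exact_mod_cast h2') hl

lemma aux_exists_root {D N : ℕ} {x y : ℤ} (h : x ^ 2 + D * y ^ 2 = N) (hc : IsCoprime x y) :
    ∃ k : ℤ, (N : ℤ) ∣ k ^ 2 + D ∧ (N : ℤ) ∣ x - k * y := by
  have hyN : IsCoprime y (N : ℤ) := by
    rw [← h]
    have h1 : IsCoprime y (x ^ 2) := hc.symm.pow_right
    have := h1.add_mul_left_right (D * y)
    rwa [show x ^ 2 + (y : ℤ) * (D * y) = x ^ 2 + D * y ^ 2 by ring] at this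
  obtain ⟨u, v, huv⟩ := hyN
  refine ⟨u * x, ?_, ?_⟩
  · have : (N : ℤ) ∣ (u * x) ^ 2 + D := by
      refine ⟨u ^ 2 + D * v * (1 + u * y), ?_⟩
      have e : (v : ℤ) * N = 1 - u * y := by linarith
      have : (N : ℤ) * (u ^ 2 + D * v * (1 + u * y))
        = u ^ 2 * (N : ℤ) + D * (v * N) * (1 + u * y) := by ring
      rw [this, e, ← h]; ring
    exact this
  · refine ⟨v * x, ?_⟩
    linear_combination (-x) * huv

lemma aux_pair {D N : ℕ} (hD : 0 < D) (hN : 0 < N) {x y a b : ℤ} (h : x ^ 2 + D * y ^ 2 = N)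
    (h' : a ^ 2 + D * b ^ 2 = N) {u v : ℤ} (hu : 2 * (x * a + D * y * b) = N * u)
    (hv : 2 * (x * b - a * y) = N * v) : u ∈ Finset.Icc (-2 : ℤ) 2 ∧ v ∈ Finset.Icc (-2 : ℤ) 2 := by
  have e : u ^ 2 + D * v ^ 2 = 4 := by
    have h1 : (N : ℤ) ^ 2 * (u ^ 2 + D * v ^ 2) = N ^ 2 * 4 := by
      have : (N : ℤ) ^ 2 * (u ^ 2 + D * v ^ 2) = (N * u) ^ 2 + D * (N * v) ^ 2 := by ring
      rw [this, ← hu, ← hv, sq (N : ℤ)]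
      nth_rewrite 1 [← h]
      rw [← h']; ring
    have hN' : (N : ℤ) ^ 2 ≠ 0 := by positivity
    exact mul_left_cancel₀ hN' h1
  have hD' : (1 : ℤ) ≤ D := by exact_mod_cast hD
  simp only [Finset.mem_Icc]
  have hv2 : v ^ 2 ≤ 4 := by nlinarith [sq_nonneg u, sq_nonneg v]
  have hu2 : u ^ 2 ≤ 4 := by nlinarith [sq_nonneg u, sq_nonneg v]
  refine ⟨⟨?_, ?_⟩, ?_, ?_⟩ <;> nlinarith

lemma aux_prim {D N : ℕ} (hD : 0 < D) (hN : 0 < N) (hsq : Squarefree (Nat.gcd D N))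
    (S : Finset (ℤ × ℤ))
    (hS : ∀ z ∈ S, z.1 ^ 2 + D * z.2 ^ 2 = N ∧ IsCoprime z.1 z.2) :
    #S ≤ 25 * #N.divisors := by
  classical
  have hex : ∀ z : ℤ × ℤ, ∃ k : ℤ, z ∈ S → (N : ℤ) ∣ k ^ 2 + D ∧ (N : ℤ) ∣ z.1 - k * z.2 := by
    intro z
    by_cases hz : z ∈ S
    · obtain ⟨k, hk⟩ := aux_exists_root (hS z hz).1 (hS z hz).2
      exact ⟨k, fun _ => hk⟩
    · exact ⟨0, fun h => absurd h hz⟩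
  choose k hk using hex
  rcases S.eq_empty_or_nonempty with rfl | ⟨w, hw⟩
  · simp
  refine Finset.card_le_mul_card_image_of_maps_to
    (f := fun z => Int.gcd (k z - k w) N) (t := N.divisors) ?_ 25 ?_
  · intro z hz
    simp only [Nat.mem_divisors]
    refine ⟨?_, hN.ne'⟩
    have := Int.gcd_dvd_right (k z - k w) (N : ℤ)
    exact_mod_cast this
  · intro g _
    rcases (S.filter (fun z => Int.gcd (k z - k w) N = g)).eq_empty_or_nonempty with he | ⟨q, hq⟩
    · rw [he]; simp
    rw [Finset.mem_filter] at hq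
    obtain ⟨hqS, hqg⟩ := hq
    have hdv : ∀ z ∈ S.filter (fun z => Int.gcd (k z - k w) N = g),
        (N : ℤ) ∣ 2 * (z.1 * q.1 + D * z.2 * q.2) ∧ (N : ℤ) ∣ 2 * (z.1 * q.2 - q.1 * z.2) := by
      intro z hz
      rw [Finset.mem_filter] at hz
      obtain ⟨hzS, hzg⟩ := hz
      obtain ⟨r, hr⟩ := aux_root hN hsq (hk w hw).1 (hk z hzS).1 (hk q hqS).1 (hzg.trans hqg.symm)
      obtain ⟨a, ha⟩ := (hk z hzS).2
      obtain ⟨b, hb⟩ := (hk q hqS).2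
      obtain ⟨c, hc⟩ := (hk z hzS).1
      have hz1 : z.1 = k z * z.2 + N * a := by linarith
      have hq1 : q.1 = k q * q.2 + N * b := by linarith
      constructor
      · rw [hz1, hq1]
        refine ⟨2 * (k z * z.2 * b + a * k q * q.2 + N * a * b) + z.2 * q.2 * (2 * c - k z * r), ?_⟩
        linear_combination (2 * z.2 * q.2) * hc - z.2 * q.2 * k z * hr
      · rw [hz1, hq1]
        refine ⟨2 * (a * q.2 - b * z.2) + r * z.2 * q.2, ?_⟩
        linear_combination (z.2 * q.2) * hr
    have hc25 : #((Finset.Icc (-2 : ℤ) 2) ×ˢ (Finset.Icc (-2 : ℤ) 2)) = 25 := by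
      rw [Finset.card_product]; simp
    rw [← hc25]
    apply Finset.card_le_card_of_injOn
      (fun z => (2 * (z.1 * q.1 + D * z.2 * q.2) / (N : ℤ), 2 * (z.1 * q.2 - q.1 * z.2) / (N : ℤ)))
    · intro z hz
      obtain ⟨⟨u, hu⟩, ⟨v, hv⟩⟩ := hdv z hz
      have hN' : (N : ℤ) ≠ 0 := by positivity
      simp only [hu, hv, Int.mul_ediv_cancel_left _ hN']
      have hzS := (Finset.mem_filter.mp hz).1
      have := aux_pair hD hN (hS z hzS).1 (hS q hqS).1 hu hv
      simpa only [Finset.mem_coe, Finset.mem_product] using this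
    · intro z hz z' hz' heq
      obtain ⟨⟨u, hu⟩, ⟨v, hv⟩⟩ := hdv z hz
      obtain ⟨⟨u', hu'⟩, ⟨v', hv'⟩⟩ := hdv z' hz'
      have hN' : (N : ℤ) ≠ 0 := by positivity
      simp only [hu, hv, hu', hv', Int.mul_ediv_cancel_left _ hN', Prod.mk.injEq] at heq
      obtain ⟨rfl, rfl⟩ := heq
      have hqN := (hS q hqS).1
      ext
      · have : (N : ℤ) * (2 * z.1) = N * (2 * z'.1) := by
          rw [← hqN]
          linear_combination q.1 * (hu - hu') + D * q.2 * (hv - hv')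
        have := mul_left_cancel₀ hN' this
        linarith
      · have : (N : ℤ) * (2 * z.2) = N * (2 * z'.2) := by
          rw [← hqN]
          linear_combination q.2 * (hu - hu') - q.1 * (hv - hv')
        have := mul_left_cancel₀ hN' this
        linarith

/-- all solutions, squarefree gcd -/
lemma aux_sqf {D N : ℕ} (hD : 0 < D) (hN : 0 < N) (hsq : Squarefree (Nat.gcd D N))
    (S : Finset (ℤ × ℤ))
    (hS : ∀ z ∈ S, z.1 ^ 2 + D * z.2 ^ 2 = N) :
    #S ≤ 25 * #N.divisors * #N.divisors := by
  classical
  have hdv : ∀ z ∈ S, Int.gcd z.1 z.2 ^ 2 ∣ N := by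
    intro z hz
    obtain ⟨a, ha⟩ := Int.gcd_dvd_left z.1 z.2
    obtain ⟨b, hb⟩ := Int.gcd_dvd_right z.1 z.2
    have h := hS z hz
    have : ((Int.gcd z.1 z.2 : ℤ)) ^ 2 ∣ N := by
      rw [← h]
      generalize (Int.gcd z.1 z.2 : ℤ) = g at *
      rw [ha, hb]
      exact ⟨a ^ 2 + D * b ^ 2, by ring⟩
    exact_mod_cast this
  refine Finset.card_le_mul_card_image_of_maps_to
    (f := fun z => Int.gcd z.1 z.2) (t := N.divisors) ?_ _ ?_
  · intro z hz
    simp only [Nat.mem_divisors]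
    exact ⟨(Dvd.intro_left (Int.gcd z.1 z.2) (by ring)).trans (hdv z hz), hN.ne'⟩
  · intro g _
    rcases (S.filter (fun z => Int.gcd z.1 z.2 = g)).eq_empty_or_nonempty with he | ⟨q, hq⟩
    · rw [he]; simp
    rw [Finset.mem_filter] at hq
    have hg : g ^ 2 ∣ N := hq.2 ▸ hdv q hq.1
    obtain ⟨M, hM⟩ := hg
    have hM0 : 0 < M := by
      rcases Nat.eq_zero_or_pos M with h | h
      · subst h; simp at hM; omega
      · exact h
    have hg0 : 0 < g := by
      rcases Nat.eq_zero_or_pos g with h | h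
      · subst h; simp at hM; omega
      · exact h
    have hg' : (g : ℤ) ≠ 0 := by positivity
    have hMN : M ∣ N := ⟨g ^ 2, by rw [hM]; ring⟩
    have hsq' : Squarefree (Nat.gcd D M) :=
      hsq.squarefree_of_dvd (Nat.gcd_dvd_gcd_of_dvd_right _ hMN)
    have hrep : ∀ z ∈ S.filter (fun z => Int.gcd z.1 z.2 = g),
        ∃ a b : ℤ, z.1 = g * a ∧ z.2 = g * b ∧ IsCoprime a b := by
      intro z hz
      rw [Finset.mem_filter] at hz
      obtain ⟨a, ha⟩ := Int.gcd_dvd_left z.1 z.2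
      obtain ⟨b, hb⟩ := Int.gcd_dvd_right z.1 z.2
      rw [hz.2] at ha hb
      refine ⟨a, b, ha, hb, ?_⟩
      rw [Int.isCoprime_iff_gcd_eq_one]
      have := hz.2
      rw [ha, hb, Int.gcd_mul_left] at this
      simp only [Int.natAbs_natCast] at this
      exact Nat.eq_of_mul_eq_mul_left hg0 (by omega)
    have hinj : Set.InjOn (fun z : ℤ × ℤ => (z.1 / (g : ℤ), z.2 / (g : ℤ)))
        (S.filter (fun z => Int.gcd z.1 z.2 = g) : Finset (ℤ × ℤ)) := by
      intro z hz z' hz' heq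
      obtain ⟨a, b, ha, hb, _⟩ := hrep z hz
      obtain ⟨a', b', ha', hb', _⟩ := hrep z' hz'
      simp only [ha, hb, ha', hb', Int.mul_ediv_cancel_left _ hg', Prod.mk.injEq] at heq
      ext
      · rw [ha, ha', heq.1]
      · rw [hb, hb', heq.2]
    rw [← Finset.card_image_of_injOn hinj]
    refine (aux_prim hD hM0 hsq' _ ?_).trans
      (Nat.mul_le_mul_left _ (Finset.card_le_card (Nat.divisors_subset_of_dvd hN.ne' hMN)))
    intro y hy
    rw [Finset.mem_image] at hy
    obtain ⟨z, hz, rfl⟩ := hy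
    obtain ⟨a, b, ha, hb, hab⟩ := hrep z hz
    have h := hS z (Finset.mem_filter.mp hz).1
    simp only [ha, hb, Int.mul_ediv_cancel_left _ hg']
    refine ⟨?_, hab⟩
    have hgg : (g : ℤ) ^ 2 ≠ 0 := by positivity
    apply mul_left_cancel₀ hgg
    have : (N : ℤ) = g ^ 2 * M := by exact_mod_cast hM
    rw [← this, ← h, ha, hb]; ring

lemma aux_all {D N : ℕ} (hD : 0 < D) (hN : 0 < N) (S : Finset (ℤ × ℤ))
    (hS : ∀ z ∈ S, z.1 ^ 2 + D * z.2 ^ 2 = N) :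
    #S ≤ 25 * #N.divisors * #N.divisors := by
  classical
  obtain ⟨a, b, hab, ha⟩ := Nat.sq_mul_squarefree (Nat.gcd D N)
  have hgpos : 0 < Nat.gcd D N := Nat.gcd_pos_of_pos_left _ hD
  have hb0 : 0 < b := by
    rcases Nat.eq_zero_or_pos b with h | h
    · subst h; simp at hab; omega
    · exact h
  have hbd : b ^ 2 ∣ Nat.gcd D N := ⟨a, hab.symm⟩
  obtain ⟨D', hD'⟩ := hbd.trans (Nat.gcd_dvd_left _ _)
  obtain ⟨M, hM⟩ := hbd.trans (Nat.gcd_dvd_right _ _)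
  have hM0 : 0 < M := by
    rcases Nat.eq_zero_or_pos M with h | h
    · subst h; simp at hM; omega
    · exact h
  have hD0 : 0 < D' := by
    rcases Nat.eq_zero_or_pos D' with h | h
    · subst h; simp at hD'; omega
    · exact h
  have hMN : M ∣ N := ⟨b ^ 2, by rw [hM]; ring⟩
  have hsq : Squarefree (Nat.gcd D' M) := by
    rw [hD', hM, Nat.gcd_mul_left] at hab
    have := Nat.eq_of_mul_eq_mul_left (by positivity) hab
    rwa [← this]
  have hb' : (b : ℤ) ≠ 0 := by positivity
  have hrep : ∀ z ∈ S, ∃ x : ℤ, z.1 = b * x := by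
    intro z hz
    have h := hS z hz
    have : (b : ℤ) ^ 2 ∣ z.1 ^ 2 := by
      refine ⟨M - D' * z.2 ^ 2, ?_⟩
      rw [hD', hM] at h
      push_cast at h
      linear_combination h
    exact (Int.pow_dvd_pow_iff (by norm_num)).mp this
  have hinj : Set.InjOn (fun z : ℤ × ℤ => (z.1 / (b : ℤ), z.2)) (S : Set (ℤ × ℤ)) := by
    intro z hz z' hz' heq
    obtain ⟨x, hx⟩ := hrep z hz
    obtain ⟨x', hx'⟩ := hrep z' hz'
    simp only [hx, hx', Int.mul_ediv_cancel_left _ hb', Prod.mk.injEq] at heq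
    ext
    · rw [hx, hx', heq.1]
    · exact heq.2
  rw [← Finset.card_image_of_injOn hinj]
  have hle := Finset.card_le_card (Nat.divisors_subset_of_dvd hN.ne' hMN)
  refine (aux_sqf hD0 hM0 hsq _ ?_).trans (by gcongr)
  intro y hy
  rw [Finset.mem_image] at hy
  obtain ⟨z, hz, rfl⟩ := hy
  obtain ⟨x, hx⟩ := hrep z hz
  have h := hS z hz
  simp only [hx, Int.mul_ediv_cancel_left _ hb']
  have hgg : (b : ℤ) ^ 2 ≠ 0 := by positivity
  apply mul_left_cancel₀ hgg
  rw [hx, hD', hM] at h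
  push_cast at h
  linear_combination h

lemma aux_divisors (ε : ℝ) (hε : 0 < ε) :
    ∃ C : ℝ, 1 ≤ C ∧ ∀ n : ℕ, 0 < n → (#n.divisors : ℝ) ≤ C * (n : ℝ) ^ ε := by
  classical
  obtain ⟨P, hP⟩ : ∃ P : ℕ, (2 : ℝ) ^ (1 / ε) ≤ P := exists_nat_ge _
  have hl2 : 0 < Real.log 2 := Real.log_pos (by norm_num)
  have hel : 0 < ε * Real.log 2 := by positivity
  set K : ℝ := 1 + 1 / (ε * Real.log 2) with hK
  have hK1 : 1 ≤ K := by rw [hK]; have : 0 < 1 / (ε * Real.log 2) := by positivity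
                         linarith
  have main : ∀ n : ℕ, 0 < n →
      (#n.divisors : ℝ) ≤ K ^ #(n.primeFactors ∩ Finset.range P) * (n : ℝ) ^ ε := by
    intro n
    induction n using Nat.recOnPosPrimePosCoprime with
    | prime_pow p e hp he =>
      intro _
      rw [Nat.divisors_prime_pow hp, Nat.primeFactors_prime_pow he.ne' hp]
      simp only [Finset.card_map, Finset.card_range]
      have hp2 : (2 : ℝ) ≤ p := by exact_mod_cast hp.two_le
      have hrw : (((p ^ e : ℕ) : ℝ)) ^ ε = ((p : ℝ) ^ ε) ^ e := by
        push_cast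
        rw [← Real.rpow_natCast, ← Real.rpow_mul (by positivity), mul_comm,
          Real.rpow_mul (by positivity), Real.rpow_natCast]
      rw [hrw]
      by_cases hpP : p < P
      · have : ({p} : Finset ℕ) ∩ Finset.range P = {p} := by
          ext x; simp; rintro rfl; exact hpP
        rw [this]
        simp only [Finset.card_singleton, pow_one]
        have h1 : ((2 : ℝ) ^ ε) ^ e ≤ ((p : ℝ) ^ ε) ^ e := by gcongr
        have h2 : 1 + e * (ε * Real.log 2) ≤ ((2 : ℝ) ^ ε) ^ e := by
          rw [Real.rpow_def_of_pos (by norm_num), ← Real.exp_nat_mul]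
          have := Real.add_one_le_exp ((e : ℝ) * (Real.log 2 * ε))
          linarith
        have h3 : ((e + 1 : ℕ) : ℝ) ≤ K * (1 + e * (ε * Real.log 2)) := by
          rw [hK]
          have : (1 + 1 / (ε * Real.log 2)) * (1 + e * (ε * Real.log 2))
            = 1 + e + e * (ε * Real.log 2) + 1 / (ε * Real.log 2) := by
            field_simp; ring
          rw [this]
          have : 0 < 1 / (ε * Real.log 2) := by positivity
          have : 0 ≤ e * (ε * Real.log 2) := by positivity
          push_cast; linarith
        calc _ ≤ _ := h3
          _ ≤ _ := by gcongr; exact h2.trans h1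
      · have : ({p} : Finset ℕ) ∩ Finset.range P = ∅ := by
          ext x; simp; rintro rfl; omega
        rw [this]
        simp only [Finset.card_empty, pow_zero, one_mul]
        have h1 : (2 : ℝ) ≤ (p : ℝ) ^ ε := by
          have : (2 : ℝ) ^ (1 / ε) ≤ p := hP.trans (by exact_mod_cast not_lt.mp hpP)
          calc (2 : ℝ) = ((2 : ℝ) ^ (1 / ε)) ^ ε := by
                rw [← Real.rpow_mul (by norm_num)]; field_simp; simp
            _ ≤ _ := by gcongr
        have h2 : ((e + 1 : ℕ) : ℝ) ≤ 2 ^ e := by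
          have : e + 1 ≤ 2 ^ e := Nat.lt_two_pow_self
          exact_mod_cast this
        calc _ ≤ _ := h2
          _ ≤ _ := by gcongr
    | zero => intro h; omega
    | one => intro _; simp
    | coprime a b ha hb hab iha ihb =>
      intro _
      rw [hab.card_divisors_mul, hab.primeFactors_mul, Finset.union_inter_distrib_right,
        Finset.card_union_of_disjoint, pow_add]
      · push_cast
        rw [Real.mul_rpow (by positivity) (by positivity)]
        calc _ ≤ _ := mul_le_mul (iha (by omega)) (ihb (by omega)) (by positivity) (by positivity)
          _ = _ := by ring
      · exact Finset.disjoint_of_subset_left Finset.inter_subset_left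
          (Finset.disjoint_of_subset_right Finset.inter_subset_left hab.disjoint_primeFactors)
  refine ⟨K ^ P, one_le_pow₀ hK1, fun n hn => (main n hn).trans ?_⟩
  gcongr
  calc _ ≤ #(Finset.range P) := Finset.card_le_card Finset.inter_subset_right
    _ = P := by simp

lemma aux_quad (ε : ℝ) (hε : 0 < ε) : ∃ K : ℝ, 1 ≤ K ∧
    ∀ A B C E F G : ℤ, A ≠ 0 → 0 < 4 * A * C - B ^ 2 → ∀ L : ℝ, 1 ≤ L →
    (((4 * A * F - 2 * B * E) ^ 2 - 4 * (4 * A * C - B ^ 2) * (4 * A * G - E ^ 2) : ℤ) : ℝ) ≤ L →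
    ∀ S : Finset (ℤ × ℤ),
    (∀ z ∈ S, A * z.1 ^ 2 + B * z.1 * z.2 + C * z.2 ^ 2 + E * z.1 + F * z.2 + G = 0) →
    (#S : ℝ) ≤ K * L ^ ε := by
  classical
  obtain ⟨K, hK1, hK⟩ := aux_divisors (ε / 2) (by positivity)
  refine ⟨25 * K ^ 2, by nlinarith, ?_⟩
  intro A B C E F G hA hΔ L hL hNL S hS
  obtain ⟨Δ, hΔd⟩ : ∃ Δ, Δ = 4 * A * C - B ^ 2 := ⟨_, rfl⟩
  rw [← hΔd] at hΔ hNL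
  obtain ⟨N, hN⟩ : ∃ N, N = (4 * A * F - 2 * B * E) ^ 2 - 4 * Δ * (4 * A * G - E ^ 2) := ⟨_, rfl⟩
  rw [← hN] at hNL
  let φ : ℤ × ℤ → ℤ × ℤ := fun z =>
    (2 * Δ * z.2 + (4 * A * F - 2 * B * E), 2 * A * z.1 + B * z.2 + E)
  have hφ : Function.Injective φ := by
    intro z z' h
    simp only [φ, Prod.mk.injEq] at h
    obtain ⟨h1, h2⟩ := h
    have e2 : z.2 = z'.2 := by
      have : Δ * z.2 = Δ * z'.2 := by linarith
      exact mul_left_cancel₀ hΔ.ne' this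
    have e1 : z.1 = z'.1 := by
      rw [e2] at h2
      have : A * z.1 = A * z'.1 := by linarith
      exact mul_left_cancel₀ hA this
    exact Prod.ext e1 e2
  have hsol : ∀ w ∈ S.image φ, w.1 ^ 2 + (4 * Δ) * w.2 ^ 2 = N := by
    intro w hw
    obtain ⟨z, hz, rfl⟩ := Finset.mem_image.mp hw
    have h := hS z hz
    simp only [φ]
    rw [hN]
    linear_combination (16 * A * Δ) * h + (4 * Δ * z.2 ^ 2) * hΔd
  rw [← Finset.card_image_of_injective S hφ]
  have hL' : 1 ≤ L ^ ε := Real.one_le_rpow hL hε.le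
  rcases lt_or_ge 0 N with hpos | hneg
  · lift N to ℕ using hpos.le
    have hN0 : 0 < N := by exact_mod_cast hpos
    lift Δ to ℕ using hΔ.le
    have hD0 : 0 < 4 * Δ := by
      have : 0 < Δ := by exact_mod_cast hΔ
      omega
    have h1 := aux_all hD0 hN0 (S.image φ) (by
      intro w hw
      have := hsol w hw
      push_cast
      exact this)
    have h2 := hK N hN0
    have h3 : (#(S.image φ) : ℝ) ≤ 25 * #N.divisors * #N.divisors := by exact_mod_cast h1
    have hNL' : (N : ℝ) ≤ L := by exact_mod_cast hNL
    have h4 : (#N.divisors : ℝ) ≤ K * L ^ (ε / 2) := by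
      refine h2.trans ?_
      gcongr
    calc _ ≤ _ := h3
      _ ≤ 25 * (K * L ^ (ε / 2)) * (K * L ^ (ε / 2)) := by gcongr
      _ = 25 * K ^ 2 * (L ^ (ε / 2) * L ^ (ε / 2)) := by ring
      _ = _ := by rw [← Real.rpow_add (by linarith), add_halves]
  · have hle : #(S.image φ) ≤ 1 := by
      rw [Finset.card_le_one]
      have hz : ∀ w ∈ S.image φ, w = (0, 0) := by
        intro w hw
        have h := hsol w hw
        have ha : w.1 ^ 2 = 0 := by nlinarith [sq_nonneg w.1, mul_nonneg hΔ.le (sq_nonneg w.2)]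
        have hb : Δ * w.2 ^ 2 = 0 := by nlinarith [sq_nonneg w.1, mul_nonneg hΔ.le (sq_nonneg w.2)]
        have hb' : w.2 ^ 2 = 0 := by
          rcases mul_eq_zero.mp hb with h | h
          · omega
          · exact h
        exact Prod.ext (by simpa using ha) (by simpa using hb')
      intro a ha b hb
      rw [hz a ha, hz b hb]
    have : (#(S.image φ) : ℝ) ≤ 1 := by exact_mod_cast hle
    have hKK : 1 ≤ 25 * K ^ 2 := by nlinarith
    nlinarith

lemma aux_mulle {u v P Q : ℤ} (hu : |u| ≤ P) (hv : |v| ≤ Q) : |u * v| ≤ P * Q := by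
  rw [abs_mul]
  exact mul_le_mul hu hv (abs_nonneg _) ((abs_nonneg _).trans hu)

lemma aux_addle {u v P Q : ℤ} (hu : |u| ≤ P) (hv : |v| ≤ Q) : |u + v| ≤ P + Q :=
  (abs_add_le u v).trans (add_le_add hu hv)

lemma aux_suble {u v P Q : ℤ} (hu : |u| ≤ P) (hv : |v| ≤ Q) : |u - v| ≤ P + Q :=
  (abs_sub u v).trans (add_le_add hu hv)

lemma aux_core (ε : ℝ) (hε : 0 < ε) : ∃ K : ℝ, 1 ≤ K ∧
    ∀ δ a b e a' b' e' m M : ℤ, δ ≠ 0 → 1 ≤ M → |δ| ≤ M → |a| ≤ M → |b| ≤ M → |e| ≤ M →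
    |a'| ≤ M → |b'| ≤ M → |e'| ≤ M → |m| ≤ M →
    ∀ S : Finset (Fin 4 → ℤ), ∀ i j k l : Fin 4, (∀ t, t = i ∨ t = j ∨ t = k ∨ t = l) →
    (∀ y ∈ S, y i ^ 2 + y j ^ 2 + y k ^ 2 + y l ^ 2 = m) →
    (∀ y ∈ S, δ * y i = a * y k + b * y l + e) →
    (∀ y ∈ S, δ * y j = a' * y k + b' * y l + e') →
    (#S : ℝ) ≤ K * (20000 * (M : ℝ) ^ 9) ^ ε := by
  classical
  obtain ⟨K, hK1, hK⟩ := aux_quad ε hε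
  refine ⟨K, hK1, ?_⟩
  intro δ a b e a' b' e' m M hδ hM hδM ha hb he ha' hb' he' hm S i j k l hall hs h1 h2
  have hinj : Set.InjOn (fun y : Fin 4 → ℤ => (y k, y l)) (S : Set (Fin 4 → ℤ)) := by
    intro y hy y' hy' heq
    simp only [Prod.mk.injEq] at heq
    have ei : y i = y' i := by
      have : δ * y i = δ * y' i := by rw [h1 y hy, h1 y' hy', heq.1, heq.2]
      exact mul_left_cancel₀ hδ this
    have ej : y j = y' j := by
      have : δ * y j = δ * y' j := by rw [h2 y hy, h2 y' hy', heq.1, heq.2]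
      exact mul_left_cancel₀ hδ this
    funext t
    rcases hall t with rfl | rfl | rfl | rfl
    · exact ei
    · exact ej
    · exact heq.1
    · exact heq.2
  rw [← Finset.card_image_of_injOn hinj]
  have hM0 : (1 : ℝ) ≤ M := by exact_mod_cast hM
  have hδ2 : 0 < δ ^ 2 := by positivity
  refine hK (δ * δ + a * a + a' * a') (2 * (a * b + a' * b')) (δ * δ + b * b + b' * b')
    (2 * (a * e + a' * e')) (2 * (b * e + b' * e')) (e * e + e' * e' - m * (δ * δ))
    (by nlinarith [sq_nonneg a, sq_nonneg a']) ?_ _ ?_ ?_ _ ?_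
  · have : 4 * (δ * δ + a * a + a' * a') * (δ * δ + b * b + b' * b') - (2 * (a * b + a' * b')) ^ 2
      = 4 * (δ ^ 2) ^ 2 + 4 * (δ ^ 2 * (a ^ 2 + a' ^ 2 + b ^ 2 + b' ^ 2)) +
        4 * (a * b' - a' * b) ^ 2 := by ring
    rw [this]; positivity
  · have := one_le_pow₀ hM0 (n := 9)
    linarith
  · have hA := aux_addle (aux_addle (aux_mulle hδM hδM) (aux_mulle ha ha)) (aux_mulle ha' ha')
    have hC := aux_addle (aux_addle (aux_mulle hδM hδM) (aux_mulle hb hb)) (aux_mulle hb' hb')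
    have t2 : |(2 : ℤ)| ≤ 2 := by norm_num
    have t4 : |(4 : ℤ)| ≤ 4 := by norm_num
    have hB := aux_mulle t2 (aux_addle (aux_mulle ha hb) (aux_mulle ha' hb'))
    have hE := aux_mulle t2 (aux_addle (aux_mulle ha he) (aux_mulle ha' he'))
    have hF := aux_mulle t2 (aux_addle (aux_mulle hb he) (aux_mulle hb' he'))
    have hG := aux_suble (aux_addle (aux_mulle he he) (aux_mulle he' he'))
      (aux_mulle hm (aux_mulle hδM hδM))
    have hV := aux_suble (aux_mulle (aux_mulle t4 hA) hF) (aux_mulle (aux_mulle t2 hB) hE)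
    have hΔ := aux_suble (aux_mulle (aux_mulle t4 hA) hC) (aux_mulle hB hB)
    have hW := aux_suble (aux_mulle (aux_mulle t4 hA) hG) (aux_mulle hE hE)
    have hN := aux_suble (aux_mulle hV hV) (aux_mulle (aux_mulle t4 hΔ) hW)
    have hN2 := (le_abs_self _).trans hN
    simp only [← sq] at hN2 ⊢
    have hfin := hN2.trans (b := _) (c := 20000 * M ^ 9) (by
      have m8 : M ^ 8 ≤ M ^ 9 := pow_le_pow_right₀ hM (by norm_num)
      have m9 : 0 ≤ M ^ 9 := by positivity
      ring_nf
      linarith)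
    exact_mod_cast hfin
  · intro z hz
    obtain ⟨y, hy, rfl⟩ := Finset.mem_image.mp hz
    have e1 := h1 y hy
    have e2 := h2 y hy
    have e3 := hs y hy
    simp only
    linear_combination (δ ^ 2) * e3 - (δ * y i + (a * y k + b * y l + e)) * e1
      - (δ * y j + (a' * y k + b' * y l + e')) * e2

lemma aux_fin4 : ∀ i j : Fin 4, i ≠ j → ∃ k l : Fin 4, (∀ t, t = i ∨ t = j ∨ t = k ∨ t = l) ∧
    i ≠ k ∧ i ≠ l ∧ j ≠ k ∧ j ≠ l ∧ k ≠ l := by decide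

lemma aux_lin (ε : ℝ) (hε : 0 < ε) : ∃ K : ℝ, 1 ≤ K ∧
    ∀ (m : ℕ) (Q R : Fin 4 → ℤ) (n r : ℤ), 1 ≤ m → (∀ t, |Q t| ≤ 4 * m) → (∀ t, |R t| ≤ 4 * m) →
    |n| ≤ 16 * m ^ 2 → |r| ≤ 16 * m ^ 2 → (∃ i j, Q i * R j ≠ Q j * R i) →
    ∀ S : Finset (Fin 4 → ℤ), (∀ y ∈ S, ∑ t, y t ^ 2 = m) →
    (∀ y ∈ S, ∑ t, Q t * y t = n) → (∀ y ∈ S, ∑ t, R t * y t = r) →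
    (#S : ℝ) ≤ K * (m : ℝ) ^ ε := by
  classical
  obtain ⟨K, hK1, hK⟩ := aux_core (ε / 27) (by positivity)
  refine ⟨K * (20000 * 128 ^ 9) ^ (ε / 27), ?_, ?_⟩
  · have : (1 : ℝ) ≤ (20000 * 128 ^ 9) ^ (ε / 27) :=
      Real.one_le_rpow (by norm_num) (by positivity)
    nlinarith
  intro m Q R n r hm hQ hR hn hr ⟨i, j, hij⟩ S hs h1 h2
  have hne : i ≠ j := by rintro rfl; exact hij rfl
  obtain ⟨k, l, hall, hik, hil, hjk, hjl, hkl⟩ := aux_fin4 i j hne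
  have hsum : ∀ f : Fin 4 → ℤ, ∑ t, f t = f i + f j + f k + f l := by
    intro f
    have : (Finset.univ : Finset (Fin 4)) = {i, j, k, l} := by
      ext t; simpa using hall t
    rw [this, Finset.sum_insert (by simp [*]), Finset.sum_insert (by simp [*]),
      Finset.sum_insert (by simp [*]), Finset.sum_singleton]
    ring
  have hmZ : (1 : ℤ) ≤ m := by exact_mod_cast hm
  have m1 : (m : ℤ) ≤ m ^ 3 := le_self_pow₀ hmZ (by norm_num)
  have m2 : (m : ℤ) ^ 2 ≤ m ^ 3 := pow_le_pow_right₀ hmZ (by norm_num)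
  have hb : ∀ s t : Fin 4, |Q s * R t - Q t * R s| ≤ 128 * (m : ℤ) ^ 3 := by
    intro s t
    refine (aux_suble (aux_mulle (hQ s) (hR t)) (aux_mulle (hQ t) (hR s))).trans ?_
    nlinarith
  have hb2 : ∀ t : Fin 4, |R t * n - Q t * r| ≤ 128 * (m : ℤ) ^ 3 := by
    intro t
    refine (aux_suble (aux_mulle (hR t) hn) (aux_mulle (hQ t) hr)).trans ?_
    nlinarith
  have h3 := hK (Q i * R j - Q j * R i) (Q j * R k - Q k * R j) (Q j * R l - Q l * R j)
    (R j * n - Q j * r)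
    (Q k * R i - Q i * R k) (Q l * R i - Q i * R l) (-(R i * n - Q i * r))
    m (128 * (m : ℤ) ^ 3) (sub_ne_zero.mpr hij) (by linarith) (hb _ _) (hb _ _) (hb _ _) (hb2 _)
    (hb _ _) (hb _ _) (by rw [abs_neg]; exact hb2 _) (by rw [abs_of_nonneg] <;> linarith)
    S i j k l hall
    (fun y hy => by rw [← hsum (fun t => y t ^ 2)]; exact hs y hy)
    (fun y hy => by
      have e1 := h1 y hy
      have e2 := h2 y hy
      rw [hsum] at e1 e2
      linear_combination R j * e1 - Q j * e2)
    (fun y hy => by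
      have e1 := h1 y hy
      have e2 := h2 y hy
      rw [hsum] at e1 e2
      linear_combination Q i * e2 - R i * e1)
  refine h3.trans (le_of_eq ?_)
  push_cast
  have : (20000 * (128 * (m : ℝ) ^ 3) ^ 9) = (20000 * 128 ^ 9) * (m : ℝ) ^ 27 := by ring
  rw [this, Real.mul_rpow (by positivity) (by positivity), mul_assoc]
  congr 2
  rw [← Real.rpow_natCast, ← Real.rpow_mul (by positivity)]
  congr 1
  push_cast; ring

lemma aux_coord {ι : Type*} [Fintype ι] {m : ℕ} {y : ι → ℤ} (h : ∑ t, y t ^ 2 = m) (t : ι) :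
    |y t| ≤ m := by
  have h1 : y t ^ 2 ≤ m := by
    rw [← h]
    exact Finset.single_le_sum (f := fun t => y t ^ 2) (fun _ _ => sq_nonneg _) (Finset.mem_univ t)
  rw [← sq_abs] at h1
  nlinarith [abs_nonneg (y t)]

lemma aux_minor {q r y : Fin 4 → ℤ} {k : Fin 4} (hk : q k ≠ 0) (hr : r ≠ 0) (hqr : q ≠ r)
    (h1 : ∑ t, q t ^ 2 = 2 * ∑ t, q t * y t) (h2 : ∑ t, r t ^ 2 = 2 * ∑ t, r t * y t) :
    ∃ i j, q i * r j ≠ q j * r i := by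
  by_contra! hcon
  have hrk : r k ≠ 0 := by
    intro h
    apply hr
    funext t
    have := hcon k t
    rw [h, mul_zero] at this
    simpa [hk] using this
  have e1 : q k * ∑ t, r t * y t = r k * ∑ t, q t * y t := by
    rw [Finset.mul_sum, Finset.mul_sum]
    refine Finset.sum_congr rfl fun t _ => ?_
    linear_combination y t * hcon k t
  have e2 : q k ^ 2 * ∑ t, r t ^ 2 = r k ^ 2 * ∑ t, q t ^ 2 := by
    rw [Finset.mul_sum, Finset.mul_sum]
    refine Finset.sum_congr rfl fun t _ => ?_
    linear_combination (q k * r t + q t * r k) * hcon k t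
  have hpos : 0 < ∑ t, q t ^ 2 :=
    Finset.sum_pos' (fun _ _ => sq_nonneg _) ⟨k, Finset.mem_univ k, by positivity⟩
  have e3 : q k * ∑ t, r t ^ 2 = r k * ∑ t, q t ^ 2 := by
    rw [h1, h2]; linear_combination 2 * e1
  have e4 : (r k * ∑ t, q t ^ 2) * q k = (r k * ∑ t, q t ^ 2) * r k := by
    linear_combination e2 - q k * e3
  have e5 : q k = r k := mul_left_cancel₀ (mul_ne_zero hrk hpos.ne') e4
  apply hqr
  funext t
  have := hcon k t
  rw [← e5, mul_comm (q t)] at this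
  exact (mul_left_cancel₀ hk this).symm

/-- properties of a difference vector -/
lemma aux_diff {ι : Type*} [Fintype ι] {m : ℕ} {p p' x : ι → ℤ}
    (h : ∑ t, (p t - x t) ^ 2 = m) (h' : ∑ t, (p' t - x t) ^ 2 = m) :
    (∀ t, |p' t - p t| ≤ 2 * m) ∧
      ∑ t, (p' t - p t) ^ 2 = 2 * ∑ t, (p' t - p t) * (x t - p t) := by
  constructor
  · intro t
    have := aux_suble (aux_coord h' t) (aux_coord h t)
    rw [show p' t - x t - (p t - x t) = p' t - p t by ring] at this
    linarith
  · have : ∑ t, ((p' t - x t) ^ 2 - (p t - x t) ^ 2) = 0 := by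
      rw [Finset.sum_sub_distrib, h, h', sub_self]
    rw [Finset.mul_sum, ← sub_eq_zero, ← Finset.sum_sub_distrib, ← this]
    refine Finset.sum_congr rfl fun t _ => ?_
    ring

lemma aux_sumsq {m : ℕ} {q : Fin 4 → ℤ} (h : ∀ t, |q t| ≤ 2 * m) :
    |∑ t, q t ^ 2| ≤ 16 * (m : ℤ) ^ 2 := by
  rw [abs_of_nonneg (Finset.sum_nonneg fun _ _ => sq_nonneg _)]
  have : ∀ t ∈ (Finset.univ : Finset (Fin 4)), q t ^ 2 ≤ 4 * (m : ℤ) ^ 2 := by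
    intro t _
    have := h t
    rw [← sq_abs]
    nlinarith [abs_nonneg (q t)]
  refine (Finset.sum_le_sum this).trans ?_
  simp; linarith

theorem aux_four (ε : ℝ) (hε : 0 < ε) : ∃ K : ℝ, 1 ≤ K ∧
    ∀ (m : ℕ) (p : Fin 3 → Fin 4 → ℤ), Function.Injective p →
    ∀ S : Finset (Fin 4 → ℤ), (∀ x ∈ S, ∀ i, ∑ k, (p i k - x k) ^ 2 = (m : ℤ)) →
    (#S : ℝ) ≤ K * (m : ℝ) ^ ε := by
  classical
  obtain ⟨K, hK1, hK⟩ := aux_lin ε hε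
  refine ⟨K, hK1, ?_⟩
  intro m p hp S hS
  rcases S.eq_empty_or_nonempty with rfl | ⟨x0, hx0⟩
  · simp; positivity
  have h0 := hS x0 hx0
  obtain ⟨b1, e1⟩ := aux_diff (h0 0) (h0 1)
  obtain ⟨b2, e2⟩ := aux_diff (h0 0) (h0 2)
  have n01 : p 0 ≠ p 1 := hp.ne (by decide)
  have n02 : p 0 ≠ p 2 := hp.ne (by decide)
  have n12 : p 1 ≠ p 2 := hp.ne (by decide)
  obtain ⟨k, hk⟩ := Function.ne_iff.mp n01
  have hm : 1 ≤ m := by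
    rcases Nat.eq_zero_or_pos m with h | h
    · subst h
      have := b1 k
      simp at this
      exact absurd (sub_eq_zero.mp this).symm hk
    · exact h
  have hmin := aux_minor (q := fun t => p 1 t - p 0 t) (r := fun t => p 2 t - p 0 t)
    (y := fun t => x0 t - p 0 t) (k := k) (fun h => hk (sub_eq_zero.mp h).symm)
    (fun h => n02 (funext fun t => (sub_eq_zero.mp (congrFun h t)).symm))
    (fun h => n12 (funext fun t => by have := congrFun h t; linarith)) e1 e2
  have hinj : Function.Injective (fun x : Fin 4 → ℤ => fun t => x t - p 0 t) := by
    intro x x' h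
    funext t
    have := congrFun h t
    simp only at this
    linarith
  rw [← Finset.card_image_of_injective S hinj]
  refine hK m (fun t => 2 * (p 1 t - p 0 t)) (fun t => 2 * (p 2 t - p 0 t))
    (∑ t, (p 1 t - p 0 t) ^ 2) (∑ t, (p 2 t - p 0 t) ^ 2) hm ?_ ?_ (aux_sumsq b1) (aux_sumsq b2)
    ?_ _ ?_ ?_ ?_
  · intro t
    have := b1 t
    rw [abs_mul]; norm_num; linarith
  · intro t
    have := b2 t
    rw [abs_mul]; norm_num; linarith
  · obtain ⟨i, j, hij⟩ := hmin
    refine ⟨i, j, fun h => hij ?_⟩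
    try simp only at h ⊢
    linarith
  all_goals
    intro y hy
    obtain ⟨x, hx, rfl⟩ := Finset.mem_image.mp hy
  · rw [← hS x hx 0]
    exact Finset.sum_congr rfl fun t _ => by ring
  · rw [(aux_diff (hS x hx 0) (hS x hx 1)).2, Finset.mul_sum]
    exact Finset.sum_congr rfl fun t _ => by ring
  · rw [(aux_diff (hS x hx 0) (hS x hx 2)).2, Finset.mul_sum]
    exact Finset.sum_congr rfl fun t _ => by ring

theorem aux_three (ε : ℝ) (hε : 0 < ε) : ∃ K : ℝ, 1 ≤ K ∧
    ∀ (m : ℕ) (p : Fin 2 → Fin 3 → ℤ), Function.Injective p →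
    ∀ S : Finset (Fin 3 → ℤ), (∀ x ∈ S, ∀ i, ∑ k, (p i k - x k) ^ 2 = (m : ℤ)) →
    (#S : ℝ) ≤ K * (m : ℝ) ^ ε := by
  classical
  obtain ⟨K, hK1, hK⟩ := aux_lin ε hε
  refine ⟨K, hK1, ?_⟩
  intro m p hp S hS
  rcases S.eq_empty_or_nonempty with rfl | ⟨x0, hx0⟩
  · simp; positivity
  have h0 := hS x0 hx0
  obtain ⟨b1, e1⟩ := aux_diff (h0 0) (h0 1)
  have n01 : p 0 ≠ p 1 := hp.ne (by decide)
  obtain ⟨k, hk⟩ := Function.ne_iff.mp n01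
  have hm : 1 ≤ m := by
    rcases Nat.eq_zero_or_pos m with h | h
    · subst h
      have := b1 k
      simp at this
      exact absurd (sub_eq_zero.mp this).symm hk
    · exact h
  have hmZ : (1 : ℤ) ≤ m := by exact_mod_cast hm
  have hinj : Function.Injective
      (fun x : Fin 3 → ℤ => (Fin.cons 0 (fun t => x t - p 0 t) : Fin 4 → ℤ)) := by
    intro x x' h
    funext t
    have := congrFun h t.succ
    simp only [Fin.cons_succ] at this
    linarith
  rw [← Finset.card_image_of_injective S hinj]
  have hsq : |∑ t, (p 1 t - p 0 t) ^ 2| ≤ 16 * (m : ℤ) ^ 2 := by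
    have := aux_sumsq (m := m) (q := Fin.cons 0 (fun t => p 1 t - p 0 t)) (by
      intro t
      refine Fin.cases ?_ (fun t => ?_) t
      · simp
      · simpa using b1 t)
    rw [Fin.sum_univ_succ] at this
    simpa using this
  refine hK m (Fin.cons 0 (fun t => 2 * (p 1 t - p 0 t))) (Fin.cons 1 (fun _ => 0))
    (∑ t, (p 1 t - p 0 t) ^ 2) 0 hm ?_ ?_ hsq (by simp)
    ⟨0, k.succ, ?_⟩ _ ?_ ?_ ?_
  · intro t
    refine Fin.cases ?_ (fun t => ?_) t
    · simp
    · have := b1 t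
      rw [Fin.cons_succ, abs_mul]; norm_num; linarith
  · intro t
    refine Fin.cases ?_ (fun t => ?_) t
    · simp; linarith
    · simp
  · simp only [Fin.cons_zero, Fin.cons_succ]
    intro h
    apply hk
    linarith
  all_goals
    intro y hy
    obtain ⟨x, hx, rfl⟩ := Finset.mem_image.mp hy
    rw [Fin.sum_univ_succ]
    simp only [Fin.cons_zero, Fin.cons_succ]
  · rw [← hS x hx 0]
    simp only [ne_eq, OfNat.ofNat_ne_zero, not_false_eq_true, zero_pow, zero_add]
    exact Finset.sum_congr rfl fun t _ => by ring
  · rw [(aux_diff (hS x hx 0) (hS x hx 1)).2, Finset.mul_sum, zero_mul, zero_add]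
    exact Finset.sum_congr rfl fun t _ => by ring
  · simp

theorem statement_13 (d : ℕ) (hd : d = 3 ∨ d = 4) (c : ℝ) (hc : 0 < c)
    (ε : ℝ) (hε : 0 < ε) :
    ∃ t : ℝ, 0 < t ∧
      ∀ m : ℕ, ∀ X : Set (Fin d → ℤ), X.Finite →
        ∀ p : Fin (d - 1) → Fin d → ℤ,
          Function.Injective p →
          (∀ i j, ((|p i j| : ℤ) : ℝ) ≤ (m : ℝ) ^ c) →
          (({x ∈ X | ∀ i, ∑ k, (p i k - x k) ^ 2 = (m : ℤ)}).ncard : ℝ) ≤ t * (m : ℝ) ^ ε := by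
  rcases hd with rfl | rfl
  · obtain ⟨K, hK1, hK⟩ := aux_three ε hε
    refine ⟨K, by linarith, fun m X hX p hp _ => ?_⟩
    have hfin : {x ∈ X | ∀ i, ∑ k, (p i k - x k) ^ 2 = (m : ℤ)}.Finite :=
      hX.subset (Set.sep_subset _ _)
    rw [Set.ncard_eq_toFinset_card _ hfin]
    refine hK m p hp _ fun x hx => ?_
    exact ((Set.Finite.mem_toFinset hfin).mp hx).2
  · obtain ⟨K, hK1, hK⟩ := aux_four ε hε
    refine ⟨K, by linarith, fun m X hX p hp _ => ?_⟩
    have hfin : {x ∈ X | ∀ i, ∑ k, (p i k - x k) ^ 2 = (m : ℤ)}.Finite :=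
      hX.subset (Set.sep_subset _ _)
    rw [Set.ncard_eq_toFinset_card _ hfin]
    refine hK m p hp _ fun x hx => ?_
    exact ((Set.Finite.mem_toFinset hfin).mp hx).2
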